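/- For every M ≥ 1: Σ_{j=1}^{M} (−1)^j · σ(u_j^{(M)}) · I_{1,t} I_{2,t} ⋯ I_{j,t} = (−1)^M · I_{1,t} I_{2,t} ⋯ I_{M+1,t} in the polynomial ring R. -/

import Mathlib

/-- The two arrow symbols `↙` (`sw`) and `↘` (`se`). -/
inductive Arrow : Type
  | sw  -- ↙ : multiply by `I_{1,t+r}`
  | se  -- ↘ : apply the shift `σ`
deriving DecidableEq

instance : Fintype Arrow :=
  ⟨{Arrow.sw, Arrow.se}, fun x => by cases x <;> decide⟩

/-- The ring `R = ℂ[I_{n,s} : n, s ∈ ℤ]`, realized as multivariate polynomials in the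
variables `(n, s) : ℤ × ℤ` (the variable `(n, s)` is the indeterminate `I_{n,s}`). -/
abbrev TodaRing : Type := MvPolynomial (ℤ × ℤ) ℂ

/-- The shift homomorphism `σ : R → R`, `σ(I_{n,s}) = I_{n+1,s}`. -/
noncomputable def shiftσ : TodaRing →ₐ[ℂ] TodaRing :=
  MvPolynomial.rename (fun p => (p.1 + 1, p.2))

/-- Auxiliary bracket, recursing on the *last* element of the sequence: the argument list is
the sequence `(a_1, …, a_r)` in reverse order. -/
noncomputable def bracketAux (t : ℤ) : List Arrow → TodaRing
  | [] => 1
  | Arrow.sw :: rest => MvPolynomial.X ((1 : ℤ), t + rest.length) * bracketAux t rest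
  | Arrow.se :: rest => shiftσ (bracketAux t rest)

/-- The bracket `{(a_1, …, a_r)} ∈ R`, defined by `{()} = 1`,
`{(a_1, …, a_r, ↙)} = I_{1,t+r} · {(a_1, …, a_r)}` and
`{(a_1, …, a_r, ↘)} = σ({(a_1, …, a_r)})`. -/
noncomputable def bracket (t : ℤ) (a : List Arrow) : TodaRing :=
  bracketAux t a.reverse

/-- `u_j^{(k)}`: the sum of `{a}` over all sequences `a ∈ {↙,↘}^k` containing exactly
`j - 1` symbols `↘`. -/
noncomputable def uSum (t : ℤ) (j k : ℕ) : TodaRing :=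
  ∑ a ∈ Finset.univ.filter
      (fun a : Fin k → Arrow => (List.ofFn a).count Arrow.se = j - 1),
    bracket t (List.ofFn a)

/-- The product `I_{1,t} ⋯ I_{j,t}`. -/
noncomputable def prodI (t : ℤ) (j : ℕ) : TodaRing :=
  ∏ i ∈ Finset.Icc 1 j, MvPolynomial.X (((i : ℤ), t))

lemma prodI_succ (t : ℤ) (j : ℕ) :
    prodI t (j + 1) = MvPolynomial.X ((1 : ℤ), t) * shiftσ (prodI t j) := by
  induction j with
  | zero => simp [prodI]
  | succ n ih =>
    have h : ∀ k, prodI t (k + 1) = prodI t k * MvPolynomial.X (((k + 1 : ℕ) : ℤ), t) := by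
      intro k
      simp only [prodI]
      rw [Finset.prod_Icc_succ_top (by omega)]
    rw [h (n + 1)]
    nth_rewrite 1 [ih]
    rw [h n, map_mul]
    simp only [shiftσ, MvPolynomial.rename_X]
    push_cast
    ring

/-- The alternating sum over all sequences. -/
noncomputable def altT (t : ℤ) (M : ℕ) : TodaRing :=
  ∑ a : Fin M → Arrow, (-1 : TodaRing) ^ ((List.ofFn a).count Arrow.se) *
    bracket t (List.ofFn a) * prodI t ((List.ofFn a).count Arrow.se)

lemma ofFn_snoc_arrow {M : ℕ} (a : Fin M → Arrow) (x : Arrow) :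
    List.ofFn (Fin.snoc (α := fun _ => Arrow) a x) = List.ofFn a ++ [x] := by
  rw [List.ofFn_succ']
  simp [List.concat_eq_append]

lemma sum_arrow (f : Arrow → TodaRing) : ∑ x, f x = f Arrow.sw + f Arrow.se := by
  have : (Finset.univ : Finset Arrow) = {Arrow.sw, Arrow.se} := rfl
  rw [this, Finset.sum_pair (by decide)]

lemma altT_succ (t : ℤ) (M : ℕ) :
    altT t (M + 1) = MvPolynomial.X ((1 : ℤ), t + M) * altT t M
      - MvPolynomial.X ((1 : ℤ), t) * shiftσ (altT t M) := by
  unfold altT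
  rw [← (Fin.snocEquiv (fun _ : Fin (M + 1) => Arrow)).sum_comp, Fintype.sum_prod_type,
    sum_arrow]
  simp only [Fin.snocEquiv, Equiv.coe_fn_mk, ofFn_snoc_arrow, map_sum, Finset.mul_sum]
  rw [sub_eq_add_neg, ← Finset.sum_neg_distrib]
  congr 1
  · refine Finset.sum_congr rfl fun a _ => ?_
    simp [bracket, bracketAux]
    ring
  · refine Finset.sum_congr rfl fun a _ => ?_
    simp [bracket, bracketAux, prodI_succ]
    ring

lemma altT_zero (t : ℤ) : altT t 0 = 1 := by
  simp [altT, bracket, bracketAux, prodI]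

lemma altT_pos (t : ℤ) (M : ℕ) : altT t (M + 1) = 0 := by
  induction M with
  | zero => rw [altT_succ, altT_zero]; simp
  | succ n ih => rw [altT_succ, ih]; simp

lemma altT_eq (t : ℤ) (M : ℕ) :
    altT t M = ∑ j ∈ Finset.range (M + 1), (-1 : TodaRing) ^ j * uSum t (j + 1) M * prodI t j := by
  unfold altT
  rw [← Finset.sum_fiberwise_of_maps_to (t := Finset.range (M + 1))
    (g := fun a : Fin M → Arrow => (List.ofFn a).count Arrow.se)]
  · refine Finset.sum_congr rfl fun j _ => ?_
    unfold uSum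
    rw [Finset.mul_sum, Finset.sum_mul]
    refine Finset.sum_congr (by simp) fun a ha => ?_
    rw [(Finset.mem_filter.1 ha).2, Nat.add_sub_cancel]
  · intro a _
    have := List.count_le_length (a := Arrow.se) (l := List.ofFn a)
    rw [List.length_ofFn] at this
    exact Finset.mem_range.2 (by omega)

lemma bracketAux_replicate (t : ℤ) (M : ℕ) :
    bracketAux t (List.replicate M Arrow.se) = 1 := by
  induction M with
  | zero => rfl
  | succ n ih => rw [List.replicate_succ, bracketAux, ih, map_one]

lemma uSum_top (t : ℤ) (M : ℕ) : uSum t (M + 1) M = 1 := by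
  have h : Finset.univ.filter
      (fun a : Fin M → Arrow => (List.ofFn a).count Arrow.se = M + 1 - 1) =
      {fun _ => Arrow.se} := by
    ext a
    simp only [Finset.mem_filter, Finset.mem_univ, true_and, Finset.mem_singleton,
      Nat.add_sub_cancel]
    constructor
    · intro h
      have h2 : (List.ofFn a).count Arrow.se = (List.ofFn a).length := by
        rw [h, List.length_ofFn]
      rw [List.count_eq_length] at h2
      funext i
      exact (h2 (a i) (by simp)).symm
    · rintro rfl
      simp
  unfold uSum
  rw [h, Finset.sum_singleton, bracket, List.ofFn_const, List.reverse_replicate,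
    bracketAux_replicate]

/-- Lemma C of the appendix: for every `M ≥ 1`,
`∑_{j=1}^M (-1)^j σ(u_j^{(M)}) I_{1,t} ⋯ I_{j,t} = (-1)^M I_{1,t} ⋯ I_{M+1,t}` in `R`. -/
theorem uSum_shift_relation (t : ℤ) (M : ℕ) (hM : 1 ≤ M) :
    ∑ j ∈ Finset.Icc 1 M, (-1 : TodaRing) ^ j * shiftσ (uSum t j M) *
        ∏ i ∈ Finset.Icc 1 j, MvPolynomial.X (((i : ℤ), t)) =
      (-1 : TodaRing) ^ M * ∏ i ∈ Finset.Icc 1 (M + 1), MvPolynomial.X (((i : ℤ), t)) := by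
  change ∑ j ∈ Finset.Icc 1 M, (-1 : TodaRing) ^ j * shiftσ (uSum t j M) * prodI t j =
    (-1 : TodaRing) ^ M * prodI t (M + 1)
  have h0 : altT t M = 0 := by
    obtain ⟨n, rfl⟩ : ∃ n, M = n + 1 := ⟨M - 1, by omega⟩
    exact altT_pos t n
  have h1 : ∑ j ∈ Finset.range (M + 1),
      (-1 : TodaRing) ^ j * shiftσ (uSum t (j + 1) M) * prodI t (j + 1) = 0 := by
    have h2 : MvPolynomial.X ((1 : ℤ), t) * shiftσ (altT t M) = 0 := by rw [h0]; simp
    rw [altT_eq, map_sum, Finset.mul_sum] at h2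
    rw [← h2]
    refine Finset.sum_congr rfl fun j _ => ?_
    rw [prodI_succ]
    simp only [map_mul, map_pow, map_neg, map_one]
    ring
  rw [Finset.sum_range_succ, uSum_top, map_one, mul_one] at h1
  rw [← Finset.Ico_add_one_right_eq_Icc, Finset.sum_Ico_eq_sum_range, Nat.add_sub_cancel]
  rw [← sub_eq_zero, ← neg_eq_zero, ← h1, neg_sub, sub_eq_add_neg, add_comm,
    ← Finset.sum_neg_distrib]
  congr 1
  refine Finset.sum_congr rfl fun j _ => ?_
  rw [add_comm 1 j, pow_succ]
  ring
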